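/- For all x, y, d ∈ G, the componentwise mixed composition product respects the group structure (G, ⊙) in its left argument: (x ⊙ y) ⊲ d = (x ⊲ d) ⊙ (y ⊲ d), and e ⊲ d = e, where e = (𝟙, 0). -/

import Mathlib

open scoped Classical

/-!  Common setup: noncommutative formal power series ℝ⟨⟨X⟩⟩ over the
alphabet X = {x₀, x₁}.  Words are encoded as lists over `Fin 2`
(the letter `0` is x₀ and `1` is x₁); a series is a function from words
to ℝ, recording its coefficients. -/

/-- Words over the alphabet X = {x₀, x₁}. -/
abbrev Word : Type := List (Fin 2)

/-- Noncommutative formal power series ℝ⟨⟨X⟩⟩. -/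
abbrev Ser : Type := Word → ℝ

/-- The series 𝟙 (the empty word). -/
def one1 : Ser := fun w => if w = [] then 1 else 0

/-- A single word η regarded as a series. -/
def mono (η : Word) : Ser := fun w => if w = η then 1 else 0

/-- Left concatenation of a series by the letter `x_i`. -/
def lc (i : Fin 2) (c : Ser) : Ser := fun w =>
  match w with
  | [] => 0
  | j :: u => if j = i then c u else 0

/-- Auxiliary recursion computing the coefficient of a word `w` in `c ⧢ d`:
`(c ⧢ d)(𝟙) = c(𝟙) d(𝟙)` and
`(c ⧢ d)(x_i w) = ((x_i⁻¹ c) ⧢ d)(w) + (c ⧢ (x_i⁻¹ d))(w)`,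
where `x_i⁻¹` is the left shift.  This dual recursion is exactly the
bilinear extension of the inductive shuffle of words
`(x_i ξ) ⧢ (x_j η) = x_i (ξ ⧢ x_j η) + x_j (x_i ξ ⧢ η)`, `𝟙 ⧢ η = η ⧢ 𝟙 = η`. -/
def shAux : Word → Ser → Ser → ℝ
  | [], c, d => c [] * d []
  | i :: w, c, d => shAux w (fun u => c (i :: u)) d + shAux w c (fun u => d (i :: u))

/-- The shuffle product `⧢` on ℝ⟨⟨X⟩⟩. -/
def sh (c d : Ser) : Ser := fun w => shAux w c d

/-- Shuffle powers `c^{⧢ k}`. -/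
def shPow (c : Ser) : ℕ → Ser
  | 0 => one1
  | k + 1 => sh c (shPow c k)

/-- The shuffle inverse `c^{⧢ -1} = Σ_{k ≥ 0} (𝟙 - c)^{⧢ k}`.
When `c(𝟙) = 1` the sum is locally finite (for each word only finitely many
terms are nonzero) and `∑'` returns it. -/
noncomputable def shInv (c : Ser) : Ser := fun w => ∑' k : ℕ, shPow (one1 - c) k w

/-- Composition product restricted to words: `𝟙 ∘ d = 𝟙`,
`(x₀ η) ∘ d = x₀ (η ∘ d)`, `(x₁ η) ∘ d = x₀ (d ⧢ (η ∘ d))`. -/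
def wordComp : Word → Ser → Ser
  | [], _ => one1
  | i :: η, d => if i = 0 then lc 0 (wordComp η d) else lc 0 (sh d (wordComp η d))

/-- The composition product `c ∘ d = Σ_η c(η) (η ∘ d)`.  For each fixed word
only finitely many terms are nonzero, and `∑'` returns the sum. -/
noncomputable def comp (c d : Ser) : Ser := fun w => ∑' η : Word, c η * wordComp η d w

/-- Membership in the set `G`: pairs `(d₁, d₂)` with `d₁(𝟙) = 1`. -/
def inG (d : Ser × Ser) : Prop := d.1 [] = 1

/-- Mixed composition product restricted to words: `𝟙 ◁ d = 𝟙`,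
`(x₀ η) ◁ d = x₀ (η ◁ d)`,
`(x₁ η) ◁ d = x₁ (d₁ ⧢ (η ◁ d)) + x₀ (d₂ ⧢ (η ◁ d))`. -/
def wordMComp : Word → Ser × Ser → Ser
  | [], _ => one1
  | i :: η, d =>
      if i = 0 then lc 0 (wordMComp η d)
      else lc 1 (sh d.1 (wordMComp η d)) + lc 0 (sh d.2 (wordMComp η d))

/-- The mixed composition product `c ◁ d = Σ_η c(η) (η ◁ d)`. -/
noncomputable def mcomp (c : Ser) (d : Ser × Ser) : Ser :=
  fun w => ∑' η : Word, c η * wordMComp η d w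

/-- Componentwise mixed composition `c ⊲ d = (c₁ ◁ d, c₂ ◁ d)`. -/
noncomputable def tri (c d : Ser × Ser) : Ser × Ser := (mcomp c.1 d, mcomp c.2 d)

/-- Componentwise composition `d ∘̄ c = (d₁ ∘ c, d₂ ∘ c)`. -/
noncomputable def bcomp (d : Ser × Ser) (c : Ser) : Ser × Ser := (comp d.1 c, comp d.2 c)

/-- The group product `⊙` on `G`:
`(c₁, c₂) ⊙ (d₁, d₂) = (c₁ ⧢ d₁, c₂ + d₂ ⧢ c₁)`. -/
def odot (c d : Ser × Ser) : Ser × Ser := (sh c.1 d.1, c.2 + sh d.2 c.1)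

/-- The identity element `e = (𝟙, 0)`. -/
def eG : Ser × Ser := (one1, 0)

/-- The `⊙`-inverse `c^{⊙ -1} = (c₁^{⧢ -1}, -(c₁^{⧢ -1} ⧢ c₂))`. -/
noncomputable def odotInv (c : Ser × Ser) : Ser × Ser :=
  (shInv c.1, -(sh (shInv c.1) c.2))

/-- The affine feedback group product `c ⋆ d = (c ⊲ d) ⊙ d` on `G`. -/
noncomputable def star (c d : Ser × Ser) : Ser × Ser := odot (tri c d) d

/-- The `⋆`-inverse of an element of `G` (defined via choice; for an element
of the group `(G, ⋆)` it is the unique two-sided `⋆`-inverse). -/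
noncomputable def starInv (x : Ser × Ser) : Ser × Ser :=
  if h : ∃ y : Ser × Ser, inG y ∧ star x y = eG ∧ star y x = eG then h.choose else x

/-- The affine feedback product `c @ d = c ◁ ((d^{⊙ -1}) ∘̄ c)^{⋆ -1}`. -/
noncomputable def atp (c : Ser) (d : Ser × Ser) : Ser :=
  mcomp c (starInv (bcomp (odotInv d) c))

/-- Membership in ℝ[[x₀]]: series vanishing on every word containing x₁. -/
def inRx0 (c : Ser) : Prop := ∀ w : Word, (1 : Fin 2) ∈ w → c w = 0

/-- The left shift `x_i⁻¹ c` of a series. -/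
def shift (i : Fin 2) (c : Ser) : Ser := fun u => c (i :: u)

theorem shift_add (i : Fin 2) (a b : Ser) : shift i (a + b) = shift i a + shift i b := rfl

theorem sh_nil (c d : Ser) : sh c d [] = c [] * d [] := rfl

theorem sh_cons (i : Fin 2) (w : Word) (c d : Ser) :
    sh c d (i :: w) = sh (shift i c) d w + sh c (shift i d) w := rfl

theorem shift_sh (i : Fin 2) (c d : Ser) :
    shift i (sh c d) = sh (shift i c) d + sh c (shift i d) := rfl

theorem sh_comm (c d : Ser) : sh c d = sh d c := by
  funext w
  induction w generalizing c d with
  | nil => simp only [sh_nil, mul_comm]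
  | cons i w ih => rw [sh_cons, sh_cons, ih, ih c, add_comm]

theorem sh_add (a b c : Ser) : sh a (b + c) = sh a b + sh a c := by
  funext w
  induction w generalizing a b c with
  | nil => simp only [sh_nil, Pi.add_apply, mul_add]
  | cons i w ih =>
    simp only [Pi.add_apply] at ih ⊢
    simp only [sh_cons, shift_add, ih]
    ring

theorem add_sh (a b c : Ser) : sh (a + b) c = sh a c + sh b c := by
  rw [sh_comm, sh_add, sh_comm c a, sh_comm c b]

theorem sh_smul (r : ℝ) (a b : Ser) : sh a (r • b) = r • sh a b := by
  funext w
  induction w generalizing a b with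
  | nil => simp only [sh_nil, Pi.smul_apply, smul_eq_mul]; ring
  | cons i w ih =>
    have hs : shift i (r • b) = r • shift i b := rfl
    simp only [Pi.smul_apply, smul_eq_mul] at ih ⊢
    simp only [sh_cons, hs, ih]
    ring

theorem sh_assoc (a b c : Ser) : sh (sh a b) c = sh a (sh b c) := by
  funext w
  induction w generalizing a b c with
  | nil => simp only [sh_nil, mul_assoc]
  | cons i w ih =>
    simp only [sh_cons, shift_sh, sh_add, add_sh, Pi.add_apply, ih]
    ring

/-- The coefficient of `w` in a shuffle product depends only on the coefficients of the right
factor at words no longer than `w`. -/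
theorem sh_congr_right {a b b' : Ser} {w : Word}
    (h : ∀ v : Word, v.length ≤ w.length → b v = b' v) : sh a b w = sh a b' w := by
  induction w generalizing a b b' with
  | nil => rw [sh_nil, sh_nil, h [] le_rfl]
  | cons i w ih =>
    rw [sh_cons, sh_cons, ih fun v hv => h v (hv.trans (Nat.le_succ _))]
    congr 1
    exact ih fun v hv => h (i :: v) (Nat.succ_le_succ hv)

theorem hasSum_sh {ι : Type*} (a : Ser) (g : ι → Ser)
    (hg : ∀ w, Summable fun k => g k w) (w : Word) :
    HasSum (fun k => sh a (g k) w) (sh a (fun v => ∑' k, g k v) w) := by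
  induction w generalizing a g with
  | nil => exact (hg []).hasSum.mul_left (a [])
  | cons i w ih =>
    exact (ih (shift i a) g hg).add (ih a (fun k => shift i (g k)) fun v => hg (i :: v))

theorem wordMComp_nil (d : Ser × Ser) : wordMComp [] d = one1 := rfl

theorem wordMComp_one_cons (η : Word) (d : Ser × Ser) :
    wordMComp (1 :: η) d = lc 1 (sh d.1 (wordMComp η d)) + lc 0 (sh d.2 (wordMComp η d)) := rfl

theorem wordMComp_cons_nil (i : Fin 2) (η : Word) (d : Ser × Ser) :
    wordMComp (i :: η) d [] = 0 := by
  fin_cases i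
  · rfl
  · exact add_zero 0

theorem wordMComp_zero_cons_zero_cons (η w : Word) (d : Ser × Ser) :
    wordMComp (0 :: η) d (0 :: w) = wordMComp η d w := rfl

theorem wordMComp_zero_cons_one_cons (η w : Word) (d : Ser × Ser) :
    wordMComp (0 :: η) d (1 :: w) = 0 := rfl

theorem wordMComp_one_cons_zero_cons (η w : Word) (d : Ser × Ser) :
    wordMComp (1 :: η) d (0 :: w) = sh d.2 (wordMComp η d) w := by
  simp [wordMComp_one_cons, lc]

theorem wordMComp_one_cons_one_cons (η w : Word) (d : Ser × Ser) :
    wordMComp (1 :: η) d (1 :: w) = sh d.1 (wordMComp η d) w := by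
  simp [wordMComp_one_cons, lc]

theorem sh_zero (a : Ser) : sh a 0 = 0 := by
  simpa using sh_smul 0 a 0

theorem wordMComp_eq_zero_of_length_lt (d : Ser × Ser) {η w : Word}
    (h : w.length < η.length) : wordMComp η d w = 0 := by
  induction η generalizing w with
  | nil => simp at h
  | cons i η ih =>
    cases w with
    | nil => exact wordMComp_cons_nil i η d
    | cons j w =>
      have hlt : w.length < η.length := by simpa using h
      have hsh (a : Ser) : sh a (wordMComp η d) w = 0 := by
        rw [sh_congr_right (b' := 0) fun v hv => ih (hv.trans_lt hlt), sh_zero]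
        rfl
      fin_cases i <;> fin_cases j
      · exact ih hlt
      · rfl
      · exact (wordMComp_one_cons_zero_cons η w d).trans (hsh _)
      · exact (wordMComp_one_cons_one_cons η w d).trans (hsh _)

theorem summable_mcomp (c : Ser) (d : Ser × Ser) (w : Word) :
    Summable fun η : Word => c η * wordMComp η d w := by
  refine summable_of_hasFiniteSupport ((List.finite_length_le (Fin 2) w.length).subset ?_)
  intro η hη
  by_contra hlt
  exact hη (by simp [wordMComp_eq_zero_of_length_lt d (not_le.mp hlt)])

theorem mcomp_add (a b : Ser) (d : Ser × Ser) : mcomp (a + b) d = mcomp a d + mcomp b d := by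
  funext w
  simp only [mcomp, Pi.add_apply, add_mul]
  exact (summable_mcomp a d w).tsum_add (summable_mcomp b d w)

theorem tsum_sh_wordMComp (a c : Ser) (d : Ser × Ser) (w : Word) :
    ∑' η : Word, c η * sh a (wordMComp η d) w = sh a (mcomp c d) w := by
  have h := (hasSum_sh a (fun η => c η • wordMComp η d) (summable_mcomp c d) w).tsum_eq
  simp only [sh_smul, Pi.smul_apply, smul_eq_mul] at h
  exact h

/-- Words are either empty or start with one of the two letters. -/
def wordEquiv : Unit ⊕ (Word ⊕ Word) ≃ Word where
  toFun := Sum.elim (fun _ => []) (Sum.elim (List.cons 0) (List.cons 1))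
  invFun
    | [] => .inl ()
    | i :: w => if i = 0 then .inr (.inl w) else .inr (.inr w)
  left_inv := by rintro (_ | _ | _) <;> rfl
  right_inv := by
    rintro (_ | ⟨i, w⟩)
    · rfl
    · fin_cases i <;> rfl

theorem tsum_word {f : Word → ℝ} (hf : Summable f) :
    ∑' η, f η = f [] + (∑' η, f (0 :: η) + ∑' η, f (1 :: η)) := by
  have h0 : Summable fun η => f (0 :: η) := hf.comp_injective List.cons_injective
  have h1 : Summable fun η => f (1 :: η) := hf.comp_injective List.cons_injective
  rw [← wordEquiv.tsum_eq]
  exact (HasSum.sum (f := fun s => f (wordEquiv s)) (hasSum_unique _)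
    (HasSum.sum h0.hasSum h1.hasSum)).tsum_eq

theorem mcomp_nil (c : Ser) (d : Ser × Ser) : mcomp c d [] = c [] := by
  rw [mcomp, tsum_word (summable_mcomp c d [])]
  simp [wordMComp_cons_nil, wordMComp_nil, one1]

theorem shift_zero_mcomp (c : Ser) (d : Ser × Ser) :
    shift 0 (mcomp c d) = mcomp (shift 0 c) d + sh d.2 (mcomp (shift 1 c) d) := by
  funext w
  rw [shift, mcomp, tsum_word (summable_mcomp c d _), Pi.add_apply, ← tsum_sh_wordMComp]
  simp [wordMComp_zero_cons_zero_cons, wordMComp_one_cons_zero_cons, wordMComp_nil, one1, mcomp, shift]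

theorem shift_one_mcomp (c : Ser) (d : Ser × Ser) :
    shift 1 (mcomp c d) = sh d.1 (mcomp (shift 1 c) d) := by
  funext w
  rw [shift, mcomp, tsum_word (summable_mcomp c d _), ← tsum_sh_wordMComp]
  simp [wordMComp_zero_cons_one_cons, wordMComp_one_cons_one_cons, wordMComp_nil, one1, shift]

/-- Mixed composition on the right by `d` is a shuffle homomorphism. -/
theorem mcomp_sh (a b : Ser) (d : Ser × Ser) :
    mcomp (sh a b) d = sh (mcomp a d) (mcomp b d) := by
  suffices h : ∀ (n : ℕ) (a b : Ser) (w : Word), w.length ≤ n →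
      mcomp (sh a b) d w = sh (mcomp a d) (mcomp b d) w from
    funext fun w => h w.length a b w le_rfl
  intro n
  induction n with
  | zero =>
    intro a b w hw
    rw [List.length_eq_zero_iff.mp (Nat.le_zero.mp hw)]
    simp only [mcomp_nil, sh_nil]
  | succ n ih =>
    rintro a b (_ | ⟨i, w⟩) hw
    · simp only [mcomp_nil, sh_nil]
    · have hw' : w.length ≤ n := Nat.le_of_succ_le_succ hw
      have hsh (e p q : Ser) : sh e (mcomp (sh p q) d) w = sh e (sh (mcomp p d) (mcomp q d)) w :=
        sh_congr_right fun v hv => ih p q v (hv.trans hw')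
      have hcomm (e p q : Ser) : sh p (sh e q) = sh e (sh p q) := by
        rw [← sh_assoc, sh_comm p e, sh_assoc]
      rw [sh_cons]
      change shift i (mcomp (sh a b) d) w = _
      fin_cases i
      · simp only [Fin.zero_eta, shift_zero_mcomp, shift_sh, mcomp_add, sh_add, add_sh,
          Pi.add_apply, hsh, ih _ _ _ hw', sh_assoc, hcomm d.2]
        ring
      · simp only [Fin.mk_one, shift_one_mcomp, shift_sh, mcomp_add, sh_add,
          Pi.add_apply, hsh, sh_assoc, hcomm d.1]

theorem mcomp_one1 (d : Ser × Ser) : mcomp one1 d = one1 := by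
  funext w
  rw [mcomp, tsum_eq_single [] fun η hη => by simp [one1, hη]]
  simp [one1, wordMComp]

theorem mcomp_zero (d : Ser × Ser) : mcomp 0 d = 0 := by
  funext w
  simp [mcomp]

/-- the componentwise mixed composition product respects the
group structure `(G, ⊙)` in its left argument:
`(x ⊙ y) ⊲ d = (x ⊲ d) ⊙ (y ⊲ d)` and `e ⊲ d = e`. -/
theorem tri_respects_odot (x y d : Ser × Ser)
    (hx : inG x) (hy : inG y) (hd : inG d) :
    tri (odot x y) d = odot (tri x d) (tri y d) ∧ tri eG d = eG := by
  refine ⟨Prod.ext (mcomp_sh x.1 y.1 d) ?_, Prod.ext (mcomp_one1 d) (mcomp_zero d)⟩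
  change mcomp (x.2 + sh y.2 x.1) d = mcomp x.2 d + sh (mcomp y.2 d) (mcomp x.1 d)
  rw [mcomp_add, mcomp_sh]
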